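/- arXiv:1812.01583 — 4 statements merged into one kernel-verified Lean document; each statement's English description precedes it below -/
import Mathlib

section
/- Let h : ℝ² → ℝ be C² and w : ℝ³ → ℝ³ be C¹. For x ∈ ℝ² set Γ(x) = (x₁, x₂, h(x)), V_i(x) = w_i(Γ(x)) for i = 1,2, B(x) = w₃(Γ(x)), and define U : ℝ² → ℝ² by U_i = V_i + B·∂_i h. Assume that at every point of the graph the vorticity is tangent to the graph, i.e. for every x ∈ ℝ²: (curl w)(Γ(x)) · (−∂₁h(x), −∂₂h(x), 1) = 0. Then U is a gradient field: there exists a differentiable function a : ℝ² → ℝ with ∂₁a = U₁ and ∂₂a = U₂ on ℝ². -/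
/-- Partial derivative in the `i`-th coordinate direction of a function on `ℝ²`. -/
noncomputable def pd2 (f : (Fin 2 → ℝ) → ℝ) (i : Fin 2) (x : Fin 2 → ℝ) : ℝ :=
  fderiv ℝ f x (Pi.single i 1)

/-- Partial derivative in the `i`-th coordinate direction of a function on `ℝ³`. -/
noncomputable def pd3 (f : (Fin 3 → ℝ) → ℝ) (i : Fin 3) (z : Fin 3 → ℝ) : ℝ :=
  fderiv ℝ f z (Pi.single i 1)

/-- The curl of a vector field on `ℝ³`:
`curl w = (∂₂w₃ − ∂₃w₂, ∂₃w₁ − ∂₁w₃, ∂₁w₂ − ∂₂w₁)` (0-indexed). -/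
noncomputable def curl3 (w : (Fin 3 → ℝ) → Fin 3 → ℝ) (z : Fin 3 → ℝ) : Fin 3 → ℝ :=
  ![pd3 (fun y => w y 2) 1 z - pd3 (fun y => w y 1) 2 z,
    pd3 (fun y => w y 0) 2 z - pd3 (fun y => w y 2) 0 z,
    pd3 (fun y => w y 1) 0 z - pd3 (fun y => w y 0) 1 z]

/-- If the vorticity `curl w` is tangent to the graph of `h` at every point of the graph,
then the good unknown `U = V + B ∇h` is a gradient field on `ℝ²`. -/
theorem good_unknown_is_gradient
    (h : (Fin 2 → ℝ) → ℝ) (w : (Fin 3 → ℝ) → Fin 3 → ℝ)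
    (hh : ContDiff ℝ 2 h) (hw : ContDiff ℝ 1 w)
    (Γ : (Fin 2 → ℝ) → Fin 3 → ℝ)
    (hΓ : ∀ x, Γ x = ![x 0, x 1, h x])
    (V : (Fin 2 → ℝ) → Fin 2 → ℝ) (B : (Fin 2 → ℝ) → ℝ)
    (hV : ∀ x (i : Fin 2), V x i = w (Γ x) i.castSucc)
    (hB : ∀ x, B x = w (Γ x) 2)
    (U : (Fin 2 → ℝ) → Fin 2 → ℝ)
    (hU : ∀ x (i : Fin 2), U x i = V x i + B x * pd2 h i x)
    (htan : ∀ x, (-pd2 h 0 x) * curl3 w (Γ x) 0 + (-pd2 h 1 x) * curl3 w (Γ x) 1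
        + curl3 w (Γ x) 2 = 0) :
    ∃ a : (Fin 2 → ℝ) → ℝ, Differentiable ℝ a ∧
      ∀ x, pd2 a 0 x = U x 0 ∧ pd2 a 1 x = U x 1 := by
  have hhd : Differentiable ℝ h := hh.differentiable (by norm_num)
  have hh1 : Differentiable ℝ (fderiv ℝ h) :=
    (hh.fderiv_right (m := 1) (by norm_num)).differentiable (by norm_num)
  have hwd : ∀ j : Fin 3, Differentiable ℝ (fun y => w y j) := fun j =>
    (differentiable_pi.1 (hw.differentiable (by norm_num))) j
  -- derivative of the graph map
  let G : (Fin 2 → ℝ) → ((Fin 2 → ℝ) →L[ℝ] (Fin 3 → ℝ)) := fun x =>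
    ContinuousLinearMap.pi ![ContinuousLinearMap.proj 0, ContinuousLinearMap.proj 1, fderiv ℝ h x]
  have hG : ∀ x, HasFDerivAt Γ (G x) x := by
    intro x
    rw [hasFDerivAt_pi']
    intro i
    fin_cases i
    · have : (fun x => Γ x 0) = fun x : Fin 2 → ℝ => x 0 := by
        funext y; simp [hΓ]
      simp only [Fin.zero_eta, this]
      exact hasFDerivAt_apply 0 x
    · have : (fun x => Γ x 1) = fun x : Fin 2 → ℝ => x 1 := by
        funext y; simp [hΓ]
      simp only [Fin.mk_one, this]
      exact hasFDerivAt_apply 1 x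
    · have : (fun x => Γ x 2) = h := by
        funext y; simp [hΓ]
      simp only [Fin.reduceFinMk, this]
      exact (hhd x).hasFDerivAt
  have hGe0 : ∀ x, G x (Pi.single 0 1)
      = Pi.single 0 1 + pd2 h 0 x • (Pi.single 2 1 : Fin 3 → ℝ) := by
    intro x; funext i
    fin_cases i <;> simp [G, pd2]
  have hGe1 : ∀ x, G x (Pi.single 1 1)
      = Pi.single 1 1 + pd2 h 1 x • (Pi.single 2 1 : Fin 3 → ℝ) := by
    intro x; funext i
    fin_cases i <;> simp [G, pd2]
  -- derivatives of the components of `w ∘ Γ`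
  let W : Fin 3 → (Fin 2 → ℝ) → ((Fin 2 → ℝ) →L[ℝ] ℝ) := fun j x =>
    (fderiv ℝ (fun y => w y j) (Γ x)).comp (G x)
  have hW : ∀ j x, HasFDerivAt (fun x => w (Γ x) j) (W j x) x := fun j x =>
    (hwd j (Γ x)).hasFDerivAt.comp x (hG x)
  have hWe0 : ∀ j x, W j x (Pi.single 0 1)
      = pd3 (fun y => w y j) 0 (Γ x) + pd2 h 0 x * pd3 (fun y => w y j) 2 (Γ x) := by
    intro j x
    simp only [W, ContinuousLinearMap.comp_apply, hGe0, map_add, map_smul, pd3, smul_eq_mul]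
  have hWe1 : ∀ j x, W j x (Pi.single 1 1)
      = pd3 (fun y => w y j) 1 (Γ x) + pd2 h 1 x * pd3 (fun y => w y j) 2 (Γ x) := by
    intro j x
    simp only [W, ContinuousLinearMap.comp_apply, hGe1, map_add, map_smul, pd3, smul_eq_mul]
  -- derivatives of the partial derivatives of `h`
  let H : Fin 2 → (Fin 2 → ℝ) → ((Fin 2 → ℝ) →L[ℝ] ℝ) := fun i x =>
    (fderiv ℝ (fderiv ℝ h) x).flip (Pi.single i 1)
  have hH : ∀ i x, HasFDerivAt (pd2 h i) (H i x) x := by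
    intro i x
    have := (hh1 x).hasFDerivAt.clm_apply
      (hasFDerivAt_const (Pi.single i 1 : Fin 2 → ℝ) x)
    simpa [pd2, H] using! this
  have hsymm : ∀ x, H 0 x (Pi.single 1 1) = H 1 x (Pi.single 0 1) := by
    intro x
    have := (hh.contDiffAt (x := x)).isSymmSndFDerivAt (by simp)
    exact this _ _
  let D : Fin 2 → (Fin 2 → ℝ) → ((Fin 2 → ℝ) →L[ℝ] ℝ) := fun i x =>
    W i.castSucc x + (w (Γ x) 2 • H i x + pd2 h i x • W 2 x)
  have hD : ∀ i x, HasFDerivAt (fun x => U x i) (D i x) x := by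
    intro i x
    have e : (fun x => U x i) = fun x => w (Γ x) i.castSucc + w (Γ x) 2 * pd2 h i x := by
      funext y; rw [hU, hV, hB]
    rw [e]
    exact (hW _ x).add ((hW 2 x).mul (hH i x))
  have hclosed : ∀ x, D 0 x (Pi.single 1 1) = D 1 x (Pi.single 0 1) := by
    intro x
    have ht := htan x
    have h1 := hsymm x
    simp only [curl3, Matrix.cons_val_zero, Matrix.cons_val_one, Matrix.cons_val] at ht
    simp only [D, add_apply, smul_apply, smul_eq_mul,
      hWe0, hWe1, h1, Fin.castSucc_zero, Fin.castSucc_one]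
    linarith
  let P : Fin 2 → ((Fin 2 → ℝ) →L[ℝ] ℝ) := fun i => ContinuousLinearMap.proj i
  let ω : (Fin 2 → ℝ) → ((Fin 2 → ℝ) →L[ℝ] ℝ) := fun x =>
    U x 0 • P 0 + U x 1 • P 1
  have hω : ∀ x, HasFDerivAt ω
      ((D 0 x).smulRight (P 0)
        + (D 1 x).smulRight (P 1)) x := fun x =>
    ((hD 0 x).smul_const (P 0)).add ((hD 1 x).smul_const (P 1))
  have hexp : ∀ (L : (Fin 2 → ℝ) →L[ℝ] ℝ) (u : Fin 2 → ℝ),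
      L u = u 0 * L (Pi.single 0 1) + u 1 * L (Pi.single 1 1) := by
    intro L u
    have : u = u 0 • (Pi.single 0 1 : Fin 2 → ℝ) + u 1 • (Pi.single 1 1 : Fin 2 → ℝ) := by
      funext i; fin_cases i <;> simp
    conv_lhs => rw [this]
    simp only [map_add, map_smul, smul_eq_mul]
  obtain ⟨a, ha⟩ := (convex_univ (𝕜 := ℝ) (E := Fin 2 → ℝ)).exists_forall_hasFDerivAt_of_fderiv_symmetric
    isOpen_univ (ω := ω) (fun x _ => (hω x).differentiableAt.differentiableWithinAt) (by
      intro x _ u v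
      rw [(hω x).fderiv]
      simp only [add_apply, ContinuousLinearMap.smulRight_apply,
        smul_apply, P, ContinuousLinearMap.proj_apply, smul_eq_mul]
      rw [hexp (D 0 x) u, hexp (D 0 x) v, hexp (D 1 x) u, hexp (D 1 x) v, hclosed x]
      ring)
  refine ⟨a, fun x => (ha x trivial).differentiableAt, fun x => ?_⟩
  constructor <;> simp [pd2, (ha x trivial).fderiv, ω, P]
end

section
/- Let h : ℝ × ℝ² → ℝ be C¹, and let v : ℝ × ℝ³ → ℝ³ and p : ℝ × ℝ³ → ℝ be C¹. Set Γ(t,x) = (t, x₁, x₂, h(t,x)), V_i = v_i∘Γ for i = 1,2, B = v₃∘Γ, and a = −(∂₃p)∘Γ. Assume that at every point Γ(t,x): (i) the Euler equations with gravity hold, ∂_t v_i + ∑_k v_k ∂_k v_i = −∂_i p − δ_{i3} for i = 1,2,3; (ii) p vanishes on the free surface, p(Γ(t,x)) = 0 for all (t,x); and (iii) the kinematic boundary condition ∂_t h + V₁ ∂₁h + V₂ ∂₂h = B holds. Then for every (t,x): ∂_t V_i + V₁ ∂₁V_i + V₂ ∂₂V_i = −a ∂_i h for i = 1,2, and ∂_t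 B + V₁ ∂₁B + V₂ ∂₂B = a − 1. -/
/-- Time derivative `∂_t` of a function on `ℝ × ℝ²`. -/
noncomputable def pt2 (f : ℝ × (Fin 2 → ℝ) → ℝ) (q : ℝ × (Fin 2 → ℝ)) : ℝ :=
  fderiv ℝ f q (1, 0)

/-- Spatial partial derivative `∂_i` of a function on `ℝ × ℝ²`. -/
noncomputable def ps2 (f : ℝ × (Fin 2 → ℝ) → ℝ) (i : Fin 2) (q : ℝ × (Fin 2 → ℝ)) : ℝ :=
  fderiv ℝ f q (0, Pi.single i 1)

/-- Time derivative `∂_t` of a function on `ℝ × ℝ³`. -/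
noncomputable def pt3 (f : ℝ × (Fin 3 → ℝ) → ℝ) (q : ℝ × (Fin 3 → ℝ)) : ℝ :=
  fderiv ℝ f q (1, 0)

/-- Spatial partial derivative `∂_i` of a function on `ℝ × ℝ³`. -/
noncomputable def ps3 (f : ℝ × (Fin 3 → ℝ) → ℝ) (i : Fin 3) (q : ℝ × (Fin 3 → ℝ)) : ℝ :=
  fderiv ℝ f q (0, Pi.single i 1)

theorem chain_aux (h : ℝ × (Fin 2 → ℝ) → ℝ) (F : ℝ × (Fin 3 → ℝ) → ℝ)
    (hh : ContDiff ℝ 1 h) (hF : ContDiff ℝ 1 F)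
    (Γ : ℝ × (Fin 2 → ℝ) → ℝ × (Fin 3 → ℝ))
    (hΓ : ∀ q, Γ q = (q.1, ![q.2 0, q.2 1, h q])) (q w : ℝ × (Fin 2 → ℝ)) :
    fderiv ℝ (fun r => F (Γ r)) q w
      = w.1 * pt3 F (Γ q) + w.2 0 * ps3 F 0 (Γ q) + w.2 1 * ps3 F 1 (Γ q)
        + fderiv ℝ h q w * ps3 F 2 (Γ q) := by
  have h1 : HasFDerivAt h (fderiv ℝ h q) q := (hh.differentiable (by norm_num) q).hasFDerivAt
  have h2 : HasFDerivAt F (fderiv ℝ F (Γ q)) (Γ q) :=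
    (hF.differentiable (by norm_num) _).hasFDerivAt
  let P : Fin 2 → (ℝ × (Fin 2 → ℝ)) →L[ℝ] ℝ := fun i =>
    (ContinuousLinearMap.proj (R := ℝ) (φ := fun _ : Fin 2 => ℝ) i).comp
      (ContinuousLinearMap.snd ℝ ℝ (Fin 2 → ℝ))
  let G : Fin 3 → (ℝ × (Fin 2 → ℝ)) →L[ℝ] ℝ := ![P 0, P 1, fderiv ℝ h q]
  have h3 : HasFDerivAt Γ ((ContinuousLinearMap.fst ℝ ℝ (Fin 2 → ℝ)).prod
      (ContinuousLinearMap.pi G)) q := by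
    have e : Γ = fun q => (q.1, ![q.2 0, q.2 1, h q]) := funext hΓ
    rw [e]
    refine HasFDerivAt.prodMk hasFDerivAt_fst ?_
    refine hasFDerivAt_pi.2 ?_
    intro i
    fin_cases i
    · exact (P 0).hasFDerivAt
    · exact (P 1).hasFDerivAt
    · exact h1
  have h4 := (h2.comp q h3).fderiv
  have h5 : fderiv ℝ (fun r => F (Γ r)) q = _ := h4
  rw [h5]
  have e : ((ContinuousLinearMap.fst ℝ ℝ (Fin 2 → ℝ)).prod (ContinuousLinearMap.pi G)) w
      = w.1 • ((1 : ℝ), (0 : Fin 3 → ℝ)) + w.2 0 • ((0 : ℝ), (Pi.single 0 1 : Fin 3 → ℝ))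
        + w.2 1 • ((0 : ℝ), (Pi.single 1 1 : Fin 3 → ℝ))
        + fderiv ℝ h q w • ((0 : ℝ), (Pi.single 2 1 : Fin 3 → ℝ)) := by
    refine Prod.ext (by simp) ?_
    funext i
    fin_cases i <;> simp [G, P]
  rw [ContinuousLinearMap.comp_apply, e]
  simp only [map_add, map_smul, smul_eq_mul, pt3, ps3]

theorem mat_aux (h : ℝ × (Fin 2 → ℝ) → ℝ) (F : ℝ × (Fin 3 → ℝ) → ℝ)
    (hh : ContDiff ℝ 1 h) (hF : ContDiff ℝ 1 F)
    (Γ : ℝ × (Fin 2 → ℝ) → ℝ × (Fin 3 → ℝ))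
    (hΓ : ∀ q, Γ q = (q.1, ![q.2 0, q.2 1, h q])) (q : ℝ × (Fin 2 → ℝ)) (a b c : ℝ)
    (hk : pt2 h q + a * ps2 h 0 q + b * ps2 h 1 q = c) :
    pt2 (fun r => F (Γ r)) q + a * ps2 (fun r => F (Γ r)) 0 q + b * ps2 (fun r => F (Γ r)) 1 q
      = pt3 F (Γ q) + (a * ps3 F 0 (Γ q) + b * ps3 F 1 (Γ q) + c * ps3 F 2 (Γ q)) := by
  subst hk
  unfold pt2 ps2
  simp only [chain_aux h F hh hF Γ hΓ]
  simp
  ring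

/-- Euler's equations with gravity restricted to the free surface, together with the
vanishing of the pressure on the surface and the kinematic boundary condition, give
`D̂_t V_i = −a ∂_i h` (i = 1,2) and `D̂_t B = a − 1`, where `a = −(∂₃ p) ∘ Γ`. -/
theorem boundary_equations_for_V_and_B
    (h : ℝ × (Fin 2 → ℝ) → ℝ)
    (v : ℝ × (Fin 3 → ℝ) → Fin 3 → ℝ) (p : ℝ × (Fin 3 → ℝ) → ℝ)
    (hh : ContDiff ℝ 1 h) (hv : ContDiff ℝ 1 v) (hp : ContDiff ℝ 1 p)
    (Γ : ℝ × (Fin 2 → ℝ) → ℝ × (Fin 3 → ℝ))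
    (hΓ : ∀ q, Γ q = (q.1, ![q.2 0, q.2 1, h q]))
    (V : ℝ × (Fin 2 → ℝ) → Fin 2 → ℝ) (B a : ℝ × (Fin 2 → ℝ) → ℝ)
    (hV : ∀ q (i : Fin 2), V q i = v (Γ q) i.castSucc)
    (hB : ∀ q, B q = v (Γ q) 2)
    (ha : ∀ q, a q = -ps3 p 2 (Γ q))
    (heuler : ∀ q, ∀ i : Fin 3,
      pt3 (fun r => v r i) (Γ q)
          + ∑ k : Fin 3, v (Γ q) k * ps3 (fun r => v r i) k (Γ q)
        = -ps3 p i (Γ q) - (if i = 2 then 1 else 0))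
    (hpress : ∀ q, p (Γ q) = 0)
    (hkin : ∀ q, pt2 h q + V q 0 * ps2 h 0 q + V q 1 * ps2 h 1 q = B q) :
    (∀ q (i : Fin 2),
      pt2 (fun r => V r i) q + V q 0 * ps2 (fun r => V r i) 0 q
          + V q 1 * ps2 (fun r => V r i) 1 q
        = -(a q) * ps2 h i q)
    ∧ (∀ q, pt2 B q + V q 0 * ps2 B 0 q + V q 1 * ps2 B 1 q = a q - 1) := by
  have hvi : ∀ i, ContDiff ℝ 1 (fun r => v r i) := fun i => contDiff_pi.1 hv i
  have key : ∀ q (i : Fin 3), pt2 (fun r => v (Γ r) i) q + V q 0 * ps2 (fun r => v (Γ r) i) 0 q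
      + V q 1 * ps2 (fun r => v (Γ r) i) 1 q
      = -ps3 p i (Γ q) - (if i = 2 then 1 else 0) := by
    intro q i
    rw [mat_aux h (fun r => v r i) hh (hvi i) Γ hΓ q _ _ _ (hkin q), ← heuler q i,
      Fin.sum_univ_three, hV, hV, hB]
    rfl
  have hpz : (fun r => p (Γ r)) = fun _ => (0 : ℝ) := funext hpress
  constructor
  · intro q i
    have e : (fun r => V r i) = fun r => v (Γ r) i.castSucc := funext fun r => hV r i
    rw [e, key, ha]
    have hc := chain_aux h p hh hp Γ hΓ q (0, Pi.single i 1)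
    rw [hpz] at hc
    fin_cases i
    · simp at hc
      simp [ps2]
      linarith
    · simp at hc
      simp [ps2]
      linarith
  · intro q
    have e : B = fun r => v (Γ r) 2 := funext hB
    have := key q 2
    rw [← e] at this
    rw [this, ha]
    simp
end

section
/- Let h : ℝ × ℝ² → ℝ be C², and let v : ℝ × ℝ³ → ℝ³ and p : ℝ × ℝ³ → ℝ be C¹. Set Γ(t,x) = (t, x₁, x₂, h(t,x)), V_i = v_i∘Γ for i = 1,2, B = v₃∘Γ, and define the good unknown U_i = V_i + B ∂_i h for i = 1,2. Assume that at every point Γ(t,x): (i) the Euler equations with gravity hold, ∂_t v_i + ∑_k v_k ∂_k v_i = −∂_i p − δ_{i3} for i = 1,2,3; (ii) p(Γ(t,x)) = 0 for all (t,x); and (iii) the kinematic boundary condition ∂_t h + V₁ ∂₁h + V₂ ∂₂h = B holds. Then for i = 1,2 and every (t,x): ∂_t U_i + V₁ ∂₁U_i + V₂ ∂₂U_i = −∂_i h + B ∂_i B − ((∂_i V₁)(∂₁h) + (∂_i V₂)(∂₂h)) B. -/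
theorem chain_graph (h : ℝ × (Fin 2 → ℝ) → ℝ) (hh : Differentiable ℝ h)
    (Γ : ℝ × (Fin 2 → ℝ) → ℝ × (Fin 3 → ℝ))
    (hΓ : ∀ q, Γ q = (q.1, ![q.2 0, q.2 1, h q]))
    (f : ℝ × (Fin 3 → ℝ) → ℝ) (hf : Differentiable ℝ f) (q : ℝ × (Fin 2 → ℝ)) :
    DifferentiableAt ℝ (fun r => f (Γ r)) q ∧
    ∀ w : ℝ × (Fin 2 → ℝ), fderiv ℝ (fun r => f (Γ r)) q w =
      w.1 * pt3 f (Γ q) + w.2 0 * ps3 f 0 (Γ q) + w.2 1 * ps3 f 1 (Γ q)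
        + fderiv ℝ h q w * ps3 f 2 (Γ q) := by
  have e : Γ = fun q => (q.1, ![q.2 0, q.2 1, h q]) := funext hΓ
  let P0 : (ℝ × (Fin 2 → ℝ)) →L[ℝ] ℝ :=
    (ContinuousLinearMap.proj 0).comp (ContinuousLinearMap.snd ℝ ℝ (Fin 2 → ℝ))
  let P1 : (ℝ × (Fin 2 → ℝ)) →L[ℝ] ℝ :=
    (ContinuousLinearMap.proj 1).comp (ContinuousLinearMap.snd ℝ ℝ (Fin 2 → ℝ))
  have hG : HasFDerivAt Γ ((ContinuousLinearMap.fst ℝ ℝ (Fin 2 → ℝ)).prod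
      (ContinuousLinearMap.pi ![P0, P1, fderiv ℝ h q])) q := by
    rw [e]
    refine HasFDerivAt.prodMk hasFDerivAt_fst ?_
    rw [hasFDerivAt_pi']
    intro i
    fin_cases i
    · exact P0.hasFDerivAt
    · exact P1.hasFDerivAt
    · exact (hh q).hasFDerivAt
  have hc := (hf (Γ q)).hasFDerivAt.comp q hG
  refine ⟨hc.differentiableAt, fun w => ?_⟩
  have h1 : fderiv ℝ (fun r => f (Γ r)) q = _ := hc.fderiv
  rw [h1]
  have h2 : ((ContinuousLinearMap.fst ℝ ℝ (Fin 2 → ℝ)).prod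
      (ContinuousLinearMap.pi ![P0, P1, fderiv ℝ h q])) w =
      w.1 • ((1, 0) : ℝ × (Fin 3 → ℝ)) + w.2 0 • ((0, Pi.single 0 1) : ℝ × (Fin 3 → ℝ))
       + w.2 1 • ((0, Pi.single 1 1) : ℝ × (Fin 3 → ℝ))
       + fderiv ℝ h q w • ((0, Pi.single 2 1) : ℝ × (Fin 3 → ℝ)) := by
    ext i
    · simp
    · fin_cases i <;> simp [P0, P1]
  rw [ContinuousLinearMap.comp_apply, h2]
  simp only [map_add, map_smul, smul_eq_mul, pt3, ps3]

theorem hess_graph (h : ℝ × (Fin 2 → ℝ) → ℝ) (hh : ContDiff ℝ 2 h)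
    (q w : ℝ × (Fin 2 → ℝ)) :
    DifferentiableAt ℝ (fun r => fderiv ℝ h r w) q ∧
    ∀ z, fderiv ℝ (fun r => fderiv ℝ h r w) q z = fderiv ℝ (fun r => fderiv ℝ h r z) q w := by
  have hd : DifferentiableAt ℝ (fderiv ℝ h) q :=
    ((hh.fderiv_right (m := 1) (by norm_num)).differentiable (by norm_num)) q
  have key : ∀ w, HasFDerivAt (fun r => fderiv ℝ h r w) ((fderiv ℝ (fderiv ℝ h) q).flip w) q := by
    intro w
    have := hd.hasFDerivAt.clm_apply (hasFDerivAt_const w q)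
    rwa [ContinuousLinearMap.comp_zero, zero_add] at this
  refine ⟨(key w).differentiableAt, fun z => ?_⟩
  rw [(key w).fderiv, (key z).fderiv]
  have := (hh.contDiffAt (x := q)).isSymmSndFDerivAt (by simp)
  exact this z w

/-- The evolution equation of the good unknown `U = V + B ∇h`:
`D̂_t U_i = −∂_i h + B ∂_i B − ((∂_i V₁)(∂₁h) + (∂_i V₂)(∂₂h)) B`. -/
theorem good_unknown_evolution
    (h : ℝ × (Fin 2 → ℝ) → ℝ)
    (v : ℝ × (Fin 3 → ℝ) → Fin 3 → ℝ) (p : ℝ × (Fin 3 → ℝ) → ℝ)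
    (hh : ContDiff ℝ 2 h) (hv : ContDiff ℝ 1 v) (hp : ContDiff ℝ 1 p)
    (Γ : ℝ × (Fin 2 → ℝ) → ℝ × (Fin 3 → ℝ))
    (hΓ : ∀ q, Γ q = (q.1, ![q.2 0, q.2 1, h q]))
    (V : ℝ × (Fin 2 → ℝ) → Fin 2 → ℝ) (B : ℝ × (Fin 2 → ℝ) → ℝ)
    (hV : ∀ q (i : Fin 2), V q i = v (Γ q) i.castSucc)
    (hB : ∀ q, B q = v (Γ q) 2)
    (U : ℝ × (Fin 2 → ℝ) → Fin 2 → ℝ)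
    (hU : ∀ q (i : Fin 2), U q i = V q i + B q * ps2 h i q)
    (heuler : ∀ q, ∀ i : Fin 3,
      pt3 (fun r => v r i) (Γ q)
          + ∑ k : Fin 3, v (Γ q) k * ps3 (fun r => v r i) k (Γ q)
        = -ps3 p i (Γ q) - (if i = 2 then 1 else 0))
    (hpress : ∀ q, p (Γ q) = 0)
    (hkin : ∀ q, pt2 h q + V q 0 * ps2 h 0 q + V q 1 * ps2 h 1 q = B q) :
    ∀ (i : Fin 2) q,
      pt2 (fun r => U r i) q + V q 0 * ps2 (fun r => U r i) 0 q
          + V q 1 * ps2 (fun r => U r i) 1 q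
        = -ps2 h i q + B q * ps2 B i q
          - (ps2 (fun r => V r 0) i q * ps2 h 0 q
              + ps2 (fun r => V r 1) i q * ps2 h 1 q) * B q := by
  intro i q
  have hhd : Differentiable ℝ h := hh.differentiable (by norm_num)
  have hvd : ∀ j, Differentiable ℝ (fun r => v r j) := fun j =>
    (contDiff_pi.1 hv j).differentiable (by norm_num)
  have hpd : Differentiable ℝ p := hp.differentiable (by norm_num)
  have cv := fun j => chain_graph h hhd Γ hΓ (fun r => v r j) (hvd j) q
  have cp := (chain_graph h hhd Γ hΓ p hpd q).2
  have hp0 : (fun r => p (Γ r)) = fun _ => 0 := funext hpress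
  rw [hp0] at cp
  have eV : ∀ j : Fin 2, (fun r => V r j) = fun r => v (Γ r) j.castSucc :=
    fun j => funext fun r => hV r j
  have eB : B = fun r => v (Γ r) 2 := funext hB
  have dV : ∀ j : Fin 2, DifferentiableAt ℝ (fun r => V r j) q := fun j => by
    rw [eV]; exact (cv _).1
  have dB : DifferentiableAt ℝ B q := by rw [eB]; exact (cv _).1
  have hs := fun w => hess_graph h hh q w
  have dS : ∀ j : Fin 2, DifferentiableAt ℝ (ps2 h j) q := fun j => (hs _).1
  -- derivative of U
  have eU : ∀ w, fderiv ℝ (fun r => U r i) q w = fderiv ℝ (fun r => V r i) q w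
      + (B q * fderiv ℝ (ps2 h i) q w + ps2 h i q * fderiv ℝ B q w) := by
    intro w
    have this : fderiv ℝ (fun r => V r i + B r * ps2 h i r) q = _ :=
      ((dV i).hasFDerivAt.add (dB.hasFDerivAt.mul (dS i).hasFDerivAt)).fderiv
    rw [show (fun r => U r i) = fun r => V r i + B r * ps2 h i r from
        funext fun r => hU r i, this]
    simp
  -- derivative of the kinematic condition
  have eK : ∀ w, fderiv ℝ (pt2 h) q w
      + (V q 0 * fderiv ℝ (ps2 h 0) q w + ps2 h 0 q * fderiv ℝ (fun r => V r 0) q w)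
      + (V q 1 * fderiv ℝ (ps2 h 1) q w + ps2 h 1 q * fderiv ℝ (fun r => V r 1) q w)
      = fderiv ℝ B q w := by
    intro w
    have dT : DifferentiableAt ℝ (pt2 h) q := (hs _).1
    have this : fderiv ℝ (fun r => pt2 h r + V r 0 * ps2 h 0 r + V r 1 * ps2 h 1 r) q = _ :=
      ((dT.hasFDerivAt.add ((dV 0).hasFDerivAt.mul (dS 0).hasFDerivAt)).add
        ((dV 1).hasFDerivAt.mul (dS 1).hasFDerivAt)).fderiv
    rw [show B = fun r => pt2 h r + V r 0 * ps2 h 0 r + V r 1 * ps2 h 1 r from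
        funext fun r => (hkin r).symm, this]
    simp
  have eKi := eK (0, Pi.single i 1)
  have s1 : fderiv ℝ (pt2 h) q (0, Pi.single i 1) = fderiv ℝ (ps2 h i) q (1, 0) := (hs _).2 _
  have s2 : ∀ j : Fin 2, fderiv ℝ (ps2 h j) q (0, Pi.single i 1)
      = fderiv ℝ (ps2 h i) q (0, Pi.single j 1) := fun j => (hs _).2 _
  rw [s1, s2, s2] at eKi
  have k := hkin q
  -- material derivatives
  have mat : ∀ j : Fin 3, fderiv ℝ (fun r => v (Γ r) j) q (1, 0)
      + V q 0 * fderiv ℝ (fun r => v (Γ r) j) q (0, Pi.single 0 1)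
      + V q 1 * fderiv ℝ (fun r => v (Γ r) j) q (0, Pi.single 1 1)
      = -ps3 p j (Γ q) - (if j = 2 then 1 else 0) := by
    intro j
    rw [← heuler q j, (cv j).2, (cv j).2, (cv j).2, Fin.sum_univ_three]
    have v0 : v (Γ q) 0 = V q 0 := (hV q 0).symm
    have v1 : v (Γ q) 1 = V q 1 := (hV q 1).symm
    rw [v0, v1, ← hB q, ← k]
    simp [pt2, ps2]
    ring
  have mB := mat 2
  rw [← eB] at mB
  have mV := mat i.castSucc
  rw [← eV i] at mV
  have cpi : ps3 p i.castSucc (Γ q) + ps2 h i q * ps3 p 2 (Γ q) = 0 := by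
    have := cp (0, Pi.single i 1)
    fin_cases i <;> simpa [ps2] using this.symm
  have hne : i.castSucc ≠ (2 : Fin 3) := by fin_cases i <;> decide
  rw [if_neg hne] at mV
  simp only [if_true] at mB
  change fderiv ℝ (fun r => U r i) q (1, 0) + V q 0 * fderiv ℝ (fun r => U r i) q (0, Pi.single 0 1)
    + V q 1 * fderiv ℝ (fun r => U r i) q (0, Pi.single 1 1) = -ps2 h i q
    + B q * fderiv ℝ B q (0, Pi.single i 1)
    - (fderiv ℝ (fun r => V r 0) q (0, Pi.single i 1) * ps2 h 0 q
      + fderiv ℝ (fun r => V r 1) q (0, Pi.single i 1) * ps2 h 1 q) * B q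
  rw [eU, eU, eU]
  linear_combination mV + ps2 h i q * mB + B q * eKi - cpi
end

section
/- Let I ⊆ ℝ be an open interval, h : ℝ × ℝ² → ℝ smooth, and v : ℝ × ℝ³ → ℝ³, p : ℝ × ℝ³ → ℝ smooth. Assume there are compact sets K ⊂ ℝ³ and K' ⊂ ℝ² such that v(t,z) = 0 for all t ∈ I and z ∉ K, and h(t,x) = 0 for all t ∈ I and x ∉ K'. Assume that on the closed region {(t, x₁, x₂, y) : t ∈ I, y ≤ h(t, x₁, x₂)}: the Euler equations with gravity hold, ∂_t v_i + ∑_k v_k ∂_k v_i = −∂_i p − δ_{i3} (i = 1,2,3), and ∑_k ∂_k v_k = 0; that p(t, x, h(t,x)) = 0 for all t ∈ I, x ∈ ℝ²; and that the kinematic boundary condition ∂_t h + v₁(Γ) ∂₁h + v₂(Γ) ∂₂h = v₃(Γ) holds, where Γ = Γ(t,x) = (t, x₁, x₂, h(t,x)). Then the energy E₀(t) = (1/2) ∫_{ℝ²} ∫_{−∞}^{h(t,x)} |v(t,x,y)|² dy dx + (1/2) ∫_{ℝ²} h(t,x)² dx is constant on I. -/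
open MeasureTheory

lemma ww_box_integral (g : (Fin 3 → ℝ) → ℝ) (hg : Continuous g) (R : ℝ) :
    ∫ z in Set.Icc (![-R, -R, -R] : Fin 3 → ℝ) ![R, R, 0], g z
      = ∫ x in Set.Icc (![-R, -R] : Fin 2 → ℝ) ![R, R],
          ∫ s in Set.Icc (-R) 0, g ![x 0, x 1, s] := by
  have hmp := (volume_preserving_piFinSuccAbove (fun _ : Fin 3 => ℝ) 2).symm
  have hcoe : ∀ w : ℝ × (Fin 2 → ℝ),
      (MeasurableEquiv.piFinSuccAbove (fun _ : Fin 3 => ℝ) 2).symm w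
        = ![w.2 0, w.2 1, w.1] := by
    intro w
    ext i
    change Fin.insertNth (α := fun _ => ℝ) (2 : Fin 3) w.1 w.2 i = _
    fin_cases i <;> rfl
  have hpre : (MeasurableEquiv.piFinSuccAbove (fun _ : Fin 3 => ℝ) 2).symm ⁻¹'
      (Set.Icc (![-R, -R, -R] : Fin 3 → ℝ) ![R, R, 0])
      = Set.Icc (-R) 0 ×ˢ Set.Icc (![-R, -R] : Fin 2 → ℝ) ![R, R] := by
    ext w
    rw [Set.mem_preimage, hcoe]
    simp only [Set.mem_Icc, Set.mem_prod, Pi.le_def, Fin.forall_fin_succ]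
    simp
    tauto
  have h1 := hmp.setIntegral_preimage_emb (MeasurableEquiv.measurableEmbedding _) g
    (Set.Icc (![-R, -R, -R] : Fin 3 → ℝ) ![R, R, 0])
  rw [← h1, hpre]
  simp_rw [hcoe]
  have hc : Continuous (fun w : (Fin 2 → ℝ) × ℝ => g ![w.1 0, w.1 1, w.2]) := by
    refine hg.comp (continuous_pi fun i => ?_)
    fin_cases i <;> simp <;> fun_prop
  rw [Measure.volume_eq_prod, ← setIntegral_prod_swap]
  rw [setIntegral_prod]
  · rfl
  · exact hc.continuousOn.integrableOn_compact (isCompact_Icc.prod isCompact_Icc)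

/-- projection to time and horizontal position -/
def wwL (q : Fin 4 → ℝ) : ℝ × (Fin 2 → ℝ) := (q 0, ![q 1, q 2])

/-- the flattening map -/
def wwPhi (h : ℝ × (Fin 2 → ℝ) → ℝ) (q : Fin 4 → ℝ) : ℝ × (Fin 3 → ℝ) :=
  (q 0, ![q 1, q 2, h (wwL q) + q 3])

/-- linear version of wwL -/
noncomputable def wwLc : (Fin 4 → ℝ) →L[ℝ] ℝ × (Fin 2 → ℝ) :=
  (ContinuousLinearMap.proj 0).prod
    (ContinuousLinearMap.pi ![ContinuousLinearMap.proj 1, ContinuousLinearMap.proj 2])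

lemma wwLc_apply (q : Fin 4 → ℝ) : wwLc q = wwL q := by
  refine Prod.ext rfl ?_
  ext i
  fin_cases i <;> rfl

lemma wwL_deriv (g : ℝ × (Fin 2 → ℝ) → ℝ) (hg : Differentiable ℝ g) (q : Fin 4 → ℝ) :
    ∃ G' : (Fin 4 → ℝ) →L[ℝ] ℝ, HasFDerivAt (fun q => g (wwL q)) G' q ∧
      G' (Pi.single 0 1) = pt2 g (wwL q) ∧ G' (Pi.single 1 1) = ps2 g 0 (wwL q) ∧
      G' (Pi.single 2 1) = ps2 g 1 (wwL q) ∧ G' (Pi.single 3 1) = 0 := by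
  have h1 : HasFDerivAt wwL wwLc q := by
    have := wwLc.hasFDerivAt (x := q)
    rwa [show (wwLc : (Fin 4 → ℝ) → _) = wwL from funext wwLc_apply] at this
  refine ⟨_, (hg (wwL q)).hasFDerivAt.comp q h1, ?_, ?_, ?_, ?_⟩
  · have : wwL (Pi.single 0 1) = (1, 0) := by
      refine Prod.ext (by simp [wwL]) ?_
      ext i; fin_cases i <;> simp [wwL]
    simp [wwLc_apply, this, pt2]
  · have : wwL (Pi.single 1 1) = (0, Pi.single 0 1) := by
      refine Prod.ext (by simp [wwL]) ?_
      ext i; fin_cases i <;> simp [wwL]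
    simp [wwLc_apply, this, ps2]
  · have : wwL (Pi.single 2 1) = (0, Pi.single 1 1) := by
      refine Prod.ext (by simp [wwL]) ?_
      ext i; fin_cases i <;> simp [wwL]
    simp [wwLc_apply, this, ps2]
  · have : wwL (Pi.single 3 1) = 0 := by
      refine Prod.ext (by simp [wwL]) ?_
      ext i; fin_cases i <;> simp [wwL]
    simp [wwLc_apply, this]

lemma wwPhi_deriv (h : ℝ × (Fin 2 → ℝ) → ℝ) (hh : Differentiable ℝ h)
    (g : ℝ × (Fin 3 → ℝ) → ℝ) (hg : Differentiable ℝ g) (q : Fin 4 → ℝ) :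
    ∃ G' : (Fin 4 → ℝ) →L[ℝ] ℝ, HasFDerivAt (fun q => g (wwPhi h q)) G' q ∧
      G' (Pi.single 0 1) = pt3 g (wwPhi h q) + pt2 h (wwL q) * ps3 g 2 (wwPhi h q) ∧
      G' (Pi.single 1 1) = ps3 g 0 (wwPhi h q) + ps2 h 0 (wwL q) * ps3 g 2 (wwPhi h q) ∧
      G' (Pi.single 2 1) = ps3 g 1 (wwPhi h q) + ps2 h 1 (wwL q) * ps3 g 2 (wwPhi h q) ∧
      G' (Pi.single 3 1) = ps3 g 2 (wwPhi h q) := by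
  obtain ⟨H', hH, e0, e1, e2, e3⟩ := wwL_deriv h hh q
  let pr : Fin 4 → (Fin 4 → ℝ) →L[ℝ] ℝ := fun i => ContinuousLinearMap.proj i
  have hpr : ∀ i, HasFDerivAt (fun q : Fin 4 → ℝ => q i) (pr i) q := fun i =>
    (pr i).hasFDerivAt
  let P' : (Fin 4 → ℝ) →L[ℝ] ℝ × (Fin 3 → ℝ) :=
    (pr 0).prod (ContinuousLinearMap.pi ![pr 1, pr 2, H' + pr 3])
  have hP : HasFDerivAt (wwPhi h) P' q := by
    refine (hpr 0).prodMk (hasFDerivAt_pi.2 fun i => ?_)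
    fin_cases i
    · exact hpr 1
    · exact hpr 2
    · exact hH.add (hpr 3)
  have hPa : ∀ w, P' w = (w 0, ![w 1, w 2, H' w + w 3]) := by
    intro w
    refine Prod.ext rfl ?_
    ext i
    fin_cases i <;> rfl
  refine ⟨_, (hg (wwPhi h q)).hasFDerivAt.comp q hP, ?_, ?_, ?_, ?_⟩
  · have : P' (Pi.single 0 1) = (1, 0) + pt2 h (wwL q) • (0, Pi.single 2 1) := by
      rw [hPa, e0]
      refine Prod.ext (by simp) ?_
      ext i; fin_cases i <;> simp
    simp only [ContinuousLinearMap.comp_apply, this, map_add, map_smul, smul_eq_mul, pt3, ps3]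
  · have : P' (Pi.single 1 1) = (0, Pi.single 0 1) + ps2 h 0 (wwL q) • (0, Pi.single 2 1) := by
      rw [hPa, e1]
      refine Prod.ext (by simp) ?_
      ext i; fin_cases i <;> simp
    simp only [ContinuousLinearMap.comp_apply, this, map_add, map_smul, smul_eq_mul, pt3, ps3]
  · have : P' (Pi.single 2 1) = (0, Pi.single 1 1) + ps2 h 1 (wwL q) • (0, Pi.single 2 1) := by
      rw [hPa, e2]
      refine Prod.ext (by simp) ?_
      ext i; fin_cases i <;> simp
    simp only [ContinuousLinearMap.comp_apply, this, map_add, map_smul, smul_eq_mul, pt3, ps3]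
  · have : P' (Pi.single 3 1) = (0, Pi.single 2 1) := by
      rw [hPa, e3]
      refine Prod.ext (by simp) ?_
      ext i; fin_cases i <;> simp
    simp only [ContinuousLinearMap.comp_apply, this, ps3]

/-- kinetic energy density in flattened coordinates -/
noncomputable def wwKin (h : ℝ × (Fin 2 → ℝ) → ℝ) (v : ℝ × (Fin 3 → ℝ) → Fin 3 → ℝ)
    (q : Fin 4 → ℝ) : ℝ :=
  (1 / 2) * (v (wwPhi h q) 0 * v (wwPhi h q) 0 + v (wwPhi h q) 1 * v (wwPhi h q) 1
    + v (wwPhi h q) 2 * v (wwPhi h q) 2)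

/-- total head -/
noncomputable def wwHead (h : ℝ × (Fin 2 → ℝ) → ℝ) (v : ℝ × (Fin 3 → ℝ) → Fin 3 → ℝ)
    (p : ℝ × (Fin 3 → ℝ) → ℝ) (q : Fin 4 → ℝ) : ℝ :=
  wwKin h v q + p (wwPhi h q) + h (wwL q) + q 3

/-- the space-time current in flattened coordinates -/
noncomputable def wwFlux (h : ℝ × (Fin 2 → ℝ) → ℝ) (v : ℝ × (Fin 3 → ℝ) → Fin 3 → ℝ)
    (p : ℝ × (Fin 3 → ℝ) → ℝ) (c R : ℝ) : Fin 4 → (Fin 4 → ℝ) → ℝ :=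
  ![fun q => wwKin h v q + c * (h (wwL q) * h (wwL q)),
    fun q => v (wwPhi h q) 0 * wwHead h v p q,
    fun q => v (wwPhi h q) 1 * wwHead h v p q,
    fun q => (v (wwPhi h q) 2 - v (wwPhi h q) 0 * ps2 h 0 (wwL q)
        - v (wwPhi h q) 1 * ps2 h 1 (wwL q)) * wwHead h v p q
      - pt2 h (wwL q) * wwKin h v q
      - (2 * c) * ((q 3 + R) * (h (wwL q) * pt2 h (wwL q)))]

lemma wwFlux_deriv (h : ℝ × (Fin 2 → ℝ) → ℝ) (v : ℝ × (Fin 3 → ℝ) → Fin 3 → ℝ)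
    (p : ℝ × (Fin 3 → ℝ) → ℝ)
    (hh : ContDiff ℝ (⊤ : ℕ∞) h) (hv : ContDiff ℝ (⊤ : ℕ∞) v)
    (hp : ContDiff ℝ (⊤ : ℕ∞) p) (c R : ℝ) (q : Fin 4 → ℝ) :
    (∀ i, DifferentiableAt ℝ (wwFlux h v p c R i) q) ∧
    ((∀ i : Fin 3, pt3 (fun r => v r i) (wwPhi h q)
          + ∑ k : Fin 3, v (wwPhi h q) k * ps3 (fun r => v r i) k (wwPhi h q)
        = -ps3 p i (wwPhi h q) - (if i = 2 then 1 else 0)) →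
      (∑ k : Fin 3, ps3 (fun r => v r k) k (wwPhi h q) = 0) →
      ∑ i, fderiv ℝ (wwFlux h v p c R i) q (Pi.single i 1) = 0) := by
  have dh : Differentiable ℝ h := hh.differentiable (by simp)
  have dp : Differentiable ℝ p := hp.differentiable (by simp)
  have dv : ∀ i, Differentiable ℝ (fun r => v r i) := fun i =>
    differentiable_pi.1 (hv.differentiable (by simp)) i
  have dfh : Differentiable ℝ (fderiv ℝ h) :=
    (hh.fderiv_right (m := 1) (by norm_cast)).differentiable (by simp)
  have da : Differentiable ℝ (pt2 h) := dfh.clm_apply (differentiable_const _)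
  have ds : ∀ i, Differentiable ℝ (ps2 h i) := fun i => dfh.clm_apply (differentiable_const _)
  obtain ⟨H', hH, H0, H1, H2, H3⟩ := wwL_deriv h dh q
  obtain ⟨A', hA, -, -, -, A3⟩ := wwL_deriv _ da q
  obtain ⟨B', hB, -, -, -, B3⟩ := wwL_deriv _ (ds 0) q
  obtain ⟨C', hC, -, -, -, C3⟩ := wwL_deriv _ (ds 1) q
  obtain ⟨P', hP, P0, P1, P2, P3⟩ := wwPhi_deriv h dh p dp q
  obtain ⟨U', hU, U0, U1, U2, U3⟩ := wwPhi_deriv h dh _ (dv 0) q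
  obtain ⟨V', hV, V0, V1, V2, V3⟩ := wwPhi_deriv h dh _ (dv 1) q
  obtain ⟨W', hW, W0, W1, W2, W3⟩ := wwPhi_deriv h dh _ (dv 2) q
  have hS : HasFDerivAt (fun q : Fin 4 → ℝ => q 3)
      (ContinuousLinearMap.proj (R := ℝ) (φ := fun _ : Fin 4 => ℝ) 3) q :=
    (ContinuousLinearMap.proj (R := ℝ) (φ := fun _ : Fin 4 => ℝ) 3).hasFDerivAt
  have hK : HasFDerivAt (wwKin h v) _ q :=
    (((hU.mul hU).add (hV.mul hV)).add (hW.mul hW)).const_mul (1 / 2)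
  obtain ⟨K', hKe⟩ : ∃ K', K' = fderiv ℝ (wwKin h v) q := ⟨_, rfl⟩
  have hKa : ∀ w, K' w = v (wwPhi h q) 0 * U' w + v (wwPhi h q) 1 * V' w
      + v (wwPhi h q) 2 * W' w := by
    intro w
    rw [hKe, hK.fderiv]
    simp
    ring
  have hK2 : HasFDerivAt (wwKin h v) K' q := hKe ▸ hK.differentiableAt.hasFDerivAt
  have hT : HasFDerivAt (wwHead h v p) _ q := ((hK2.add hP).add hH).add hS
  have F0 : HasFDerivAt (wwFlux h v p c R 0) _ q := hK2.add ((hH.mul hH).const_mul c)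
  have F1 : HasFDerivAt (wwFlux h v p c R 1) _ q := hU.mul hT
  have F2 : HasFDerivAt (wwFlux h v p c R 2) _ q := hV.mul hT
  have F3 : HasFDerivAt (wwFlux h v p c R 3) _ q :=
    ((((hW.sub (hU.mul hB)).sub (hV.mul hC)).mul hT).sub (hA.mul hK2)).sub
      (((hS.add_const R).mul (hH.mul hA)).const_mul (2 * c))
  refine ⟨fun i => ?_, fun heul hdiv => ?_⟩
  · fin_cases i
    exacts [F0.differentiableAt, F1.differentiableAt, F2.differentiableAt, F3.differentiableAt]
  · rw [Fin.sum_univ_four, F0.fderiv, F1.fderiv, F2.fderiv, F3.fderiv]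
    have E0 := heul 0
    have E1 := heul 1
    have E2 := heul 2
    simp only [Fin.sum_univ_three] at E0 E1 E2 hdiv
    simp at E0 E1 E2
    simp [hKa, H0, H1, H2, H3, A3, B3, C3, P0, P1, P2, P3, U0, U1, U2, U3, V0, V1, V2, V3,
      W0, W1, W2, W3]
    linear_combination v (wwPhi h q) 0 * E0 + v (wwPhi h q) 1 * E1 + v (wwPhi h q) 2 * E2
      + wwHead h v p q * hdiv

lemma ww_energy (h : ℝ × (Fin 2 → ℝ) → ℝ)
    (v : ℝ × (Fin 3 → ℝ) → Fin 3 → ℝ) (p : ℝ × (Fin 3 → ℝ) → ℝ)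
    (hh : Continuous h) (hv : Continuous v) (R t : ℝ) (hR : 0 < R)
    (hh0 : ∀ x : Fin 2 → ℝ, (R ≤ |x 0| ∨ R ≤ |x 1|) → h (t, x) = 0)
    (hv0 : ∀ q : Fin 4 → ℝ, q 0 = t → (R ≤ |q 1| ∨ R ≤ |q 2| ∨ q 3 ≤ -R) →
      v (wwPhi h q) = 0) :
    ∫ z in Set.Icc (![-R, -R, -R] : Fin 3 → ℝ) ![R, R, 0],
        wwFlux h v p (1 / (2 * R)) R 0 ![t, z 0, z 1, z 2]
      = (1 / 2) * (∫ x : Fin 2 → ℝ,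
          ∫ y in Set.Iic (h (t, x)), ∑ i : Fin 3, (v (t, ![x 0, x 1, y]) i) ^ 2)
        + (1 / 2) * ∫ x : Fin 2 → ℝ, (h (t, x)) ^ 2 := by
  have hinner : ∀ x : Fin 2 → ℝ,
      ∫ y in Set.Iic (h (t, x)), ∑ i : Fin 3, (v (t, ![x 0, x 1, y]) i) ^ 2
        = ∫ s in Set.Icc (-R) 0, 2 * wwKin h v ![t, x 0, x 1, s] := by
    intro x
    have hx : (![x 0, x 1] : Fin 2 → ℝ) = x := by
      ext i; fin_cases i <;> rfl
    have e1 := (measurePreserving_add_left (volume : Measure ℝ) (h (t, x))).setIntegral_preimage_emb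
      (measurableEmbedding_addLeft (h (t, x)))
      (fun y => ∑ i : Fin 3, (v (t, ![x 0, x 1, y]) i) ^ 2) (Set.Iic (h (t, x)))
    rw [← e1]
    have e2 : (fun s => h (t, x) + s) ⁻¹' Set.Iic (h (t, x)) = Set.Iic 0 := by
      ext s; simp
    rw [e2]
    have e3 : ∀ s, ∑ i : Fin 3, (v (t, ![x 0, x 1, h (t, x) + s]) i) ^ 2
        = 2 * wwKin h v ![t, x 0, x 1, s] := by
      intro s
      have : wwPhi h ![t, x 0, x 1, s] = (t, ![x 0, x 1, h (t, x) + s]) := by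
        simp [wwPhi, wwL, hx]
      rw [wwKin, this, Fin.sum_univ_three]
      ring
    simp_rw [e3]
    refine setIntegral_eq_of_subset_of_forall_sdiff_eq_zero
      (s := Set.Icc (-R) 0) (t := Set.Iic (0 : ℝ)) measurableSet_Iic
      (fun s hs => hs.2) ?_
    intro s hs
    have hs' : s ≤ -R := by
      by_contra hc
      exact hs.2 ⟨(not_le.1 hc).le, hs.1⟩
    have := hv0 ![t, x 0, x 1, s] rfl (Or.inr (Or.inr hs'))
    simp [wwKin, this]
  have hmem : ∀ x : Fin 2 → ℝ, x ∉ Set.Icc (![-R, -R] : Fin 2 → ℝ) ![R, R] →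
      R ≤ |x 0| ∨ R ≤ |x 1| := by
    intro x hx
    by_contra hc
    push Not at hc
    obtain ⟨h1, h2⟩ := hc
    rw [abs_lt] at h1 h2
    apply hx
    simp only [Set.mem_Icc, Pi.le_def, Fin.forall_fin_two]
    exact ⟨⟨h1.1.le, h2.1.le⟩, h1.2.le, h2.2.le⟩
  have hcL : Continuous wwL := by
    have := wwLc.continuous
    rwa [show (wwLc : (Fin 4 → ℝ) → _) = wwL from funext wwLc_apply] at this
  have hcP : Continuous (wwPhi h) := by
    unfold wwPhi
    refine (continuous_apply 0).prodMk (continuous_pi fun i => ?_)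
    have := hh.comp hcL
    fin_cases i
    · exact continuous_apply 1
    · exact continuous_apply 2
    · exact this.add (continuous_apply 3)
  have hcv : ∀ i, Continuous (fun q => v (wwPhi h q) i) := fun i =>
    (continuous_apply i).comp (hv.comp hcP)
  have hcK : Continuous (wwKin h v) := by
    unfold wwKin
    have := hcv 0
    have := hcv 1
    have := hcv 2
    fun_prop
  have hcz : Continuous (fun z : Fin 3 → ℝ => (![t, z 0, z 1, z 2] : Fin 4 → ℝ)) := by
    refine continuous_pi fun i => ?_
    fin_cases i
    · exact continuous_const
    · exact continuous_apply 0
    · exact continuous_apply 1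
    · exact continuous_apply 2
  have hcx : Continuous (fun z : Fin 3 → ℝ => h (t, ![z 0, z 1])) :=
    hh.comp (hcL.comp hcz)
  have c1 : Continuous (fun z : Fin 3 → ℝ => wwKin h v ![t, z 0, z 1, z 2]) := hcK.comp hcz
  have c2 : Continuous (fun z : Fin 3 → ℝ =>
      1 / (2 * R) * (h (t, ![z 0, z 1]) * h (t, ![z 0, z 1]))) := by fun_prop
  have hsplit : ∀ z : Fin 3 → ℝ, wwFlux h v p (1 / (2 * R)) R 0 ![t, z 0, z 1, z 2]
      = wwKin h v ![t, z 0, z 1, z 2]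
        + 1 / (2 * R) * (h (t, ![z 0, z 1]) * h (t, ![z 0, z 1])) := fun z => rfl
  simp_rw [hsplit]
  rw [integral_add (c1.continuousOn.integrableOn_compact isCompact_Icc)
    (c2.continuousOn.integrableOn_compact isCompact_Icc),
    ww_box_integral _ c1, ww_box_integral _ c2]
  congr 1
  · simp_rw [hinner]
    rw [← integral_const_mul]
    refine Eq.trans ?_ (setIntegral_eq_integral_of_forall_compl_eq_zero
      (s := Set.Icc (![-R, -R] : Fin 2 → ℝ) ![R, R]) ?_)
    · congr 1
      ext x
      rw [← integral_const_mul]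
      congr 1
      ext s
      simp
    · intro x hx
      have hz : ∀ s, wwKin h v ![t, x 0, x 1, s] = 0 := by
        intro s
        have := hv0 ![t, x 0, x 1, s] rfl (by
          rcases hmem x hx with h1 | h1
          · exact Or.inl h1
          · exact Or.inr (Or.inl h1))
        simp [wwKin, this]
      simp [hz]
  · rw [← integral_const_mul]
    refine Eq.trans ?_ (setIntegral_eq_integral_of_forall_compl_eq_zero
      (s := Set.Icc (![-R, -R] : Fin 2 → ℝ) ![R, R]) ?_)
    · congr 1
      ext x
      have hx : (![x 0, x 1] : Fin 2 → ℝ) = x := by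
        ext i; fin_cases i <;> rfl
      simp [hx, hR.le]
      field_simp
    · intro x hx
      simp [hh0 x (hmem x hx)]

lemma ww_step
    (a b : ℝ) (h : ℝ × (Fin 2 → ℝ) → ℝ)
    (v : ℝ × (Fin 3 → ℝ) → Fin 3 → ℝ) (p : ℝ × (Fin 3 → ℝ) → ℝ)
    (hh : ContDiff ℝ (⊤ : ℕ∞) h) (hv : ContDiff ℝ (⊤ : ℕ∞) v)
    (hp : ContDiff ℝ (⊤ : ℕ∞) p)
    (K : Set (Fin 3 → ℝ)) (hK : IsCompact K)
    (hvK : ∀ t ∈ Set.Ioo a b, ∀ z ∉ K, v (t, z) = 0)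
    (K' : Set (Fin 2 → ℝ)) (hK' : IsCompact K')
    (hhK' : ∀ t ∈ Set.Ioo a b, ∀ x ∉ K', h (t, x) = 0)
    (heuler : ∀ t ∈ Set.Ioo a b, ∀ z : Fin 3 → ℝ, z 2 ≤ h (t, ![z 0, z 1]) →
      ∀ i : Fin 3,
      pt3 (fun r => v r i) (t, z)
          + ∑ k : Fin 3, v (t, z) k * ps3 (fun r => v r i) k (t, z)
        = -ps3 p i (t, z) - (if i = 2 then 1 else 0))
    (hdiv : ∀ t ∈ Set.Ioo a b, ∀ z : Fin 3 → ℝ, z 2 ≤ h (t, ![z 0, z 1]) →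
      ∑ k : Fin 3, ps3 (fun r => v r k) k (t, z) = 0)
    (hpress : ∀ t ∈ Set.Ioo a b, ∀ x : Fin 2 → ℝ, p (t, ![x 0, x 1, h (t, x)]) = 0)
    (hkin : ∀ t ∈ Set.Ioo a b, ∀ x : Fin 2 → ℝ,
      pt2 h (t, x) + v (t, ![x 0, x 1, h (t, x)]) 0 * ps2 h 0 (t, x)
          + v (t, ![x 0, x 1, h (t, x)]) 1 * ps2 h 1 (t, x)
        = v (t, ![x 0, x 1, h (t, x)]) 2)
    (E : ℝ → ℝ)
    (hE : ∀ t, E t =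
      (1 / 2) * (∫ x : Fin 2 → ℝ,
          ∫ y in Set.Iic (h (t, x)), ∑ i : Fin 3, (v (t, ![x 0, x 1, y]) i) ^ 2)
        + (1 / 2) * ∫ x : Fin 2 → ℝ, (h (t, x)) ^ 2)
    (t₁ : ℝ) (ht₁ : t₁ ∈ Set.Ioo a b) (t₂ : ℝ) (ht₂ : t₂ ∈ Set.Ioo a b) (hlt : t₁ ≤ t₂) :
    E t₁ = E t₂ := by
  have hsub : ∀ t ∈ Set.Icc t₁ t₂, t ∈ Set.Ioo a b := fun t ht =>
    ⟨ht₁.1.trans_le ht.1, ht.2.trans_lt ht₂.2⟩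
  obtain ⟨R0, hR0⟩ := hK.isBounded.exists_norm_le
  obtain ⟨R1, hR1⟩ := hK'.isBounded.exists_norm_le
  obtain ⟨M, hM⟩ := ((isCompact_Icc (a := t₁) (b := t₂)).prod hK').exists_bound_of_continuousOn
    hh.continuous.continuousOn
  have hM' : ∀ t ∈ Set.Icc t₁ t₂, ∀ x, |h (t, x)| ≤ |M| := by
    intro t ht x
    by_cases hx : x ∈ K'
    · exact (hM (t, x) ⟨ht, hx⟩).trans (le_abs_self M)
    · rw [hhK' t (hsub t ht) x hx]
      simp
  obtain ⟨R, hRdef⟩ : ∃ R, R = 1 + |R0| + |R1| + |M| := ⟨_, rfl⟩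
  have n0 := abs_nonneg R0
  have n1 := abs_nonneg R1
  have n2 := abs_nonneg M
  have l0 := le_abs_self R0
  have l1 := le_abs_self R1
  have hRpos : 0 < R := by linarith
  have hh0 : ∀ t ∈ Set.Icc t₁ t₂, ∀ x : Fin 2 → ℝ, (R ≤ |x 0| ∨ R ≤ |x 1|) →
      h (t, x) = 0 := by
    intro t ht x hx
    refine hhK' t (hsub t ht) x fun hxK => ?_
    have b0 := (norm_le_pi_norm x 0).trans (hR1 x hxK)
    have b1 := (norm_le_pi_norm x 1).trans (hR1 x hxK)
    rw [Real.norm_eq_abs] at b0 b1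
    rcases hx with hx | hx <;> linarith
  have hv0 : ∀ q : Fin 4 → ℝ, q 0 ∈ Set.Icc t₁ t₂ →
      (R ≤ |q 1| ∨ R ≤ |q 2| ∨ q 3 ≤ -R) → v (wwPhi h q) = 0 := by
    intro q hq hx
    refine hvK (q 0) (hsub _ hq) _ fun hxK => ?_
    have b0 := (norm_le_pi_norm _ 0).trans (hR0 _ hxK)
    have b1 := (norm_le_pi_norm _ 1).trans (hR0 _ hxK)
    have b2 := (norm_le_pi_norm _ 2).trans (hR0 _ hxK)
    have m := hM' _ hq ![q 1, q 2]
    simp only [Real.norm_eq_abs, wwL] at b0 b1 b2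
    simp at b0 b1 b2
    rw [abs_le] at b2 m
    rcases hx with hx | hx | hx <;> linarith
  have hDt := integral_divergence_of_hasFDerivAt_off_countable'
    (![t₁, -R, -R, -R] : Fin 4 → ℝ) ![t₂, R, R, 0]
    (by
      intro i
      fin_cases i
      · exact hlt
      · exact (neg_lt_self hRpos).le
      · exact (neg_lt_self hRpos).le
      · exact (neg_lt_zero.2 hRpos).le)
    (wwFlux h v p (1 / (2 * R)) R) (fun i => fderiv ℝ (wwFlux h v p (1 / (2 * R)) R i))
    ∅ Set.countable_empty
    (fun i q _ => ((wwFlux_deriv h v p hh hv hp (1 / (2 * R)) R q).1 i).continuousAt.continuousWithinAt)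
    (fun q _ i => ((wwFlux_deriv h v p hh hv hp (1 / (2 * R)) R q).1 i).hasFDerivAt)
  have hz : ∀ q ∈ Set.Icc (![t₁, -R, -R, -R] : Fin 4 → ℝ) ![t₂, R, R, 0],
      ∑ i, fderiv ℝ (wwFlux h v p (1 / (2 * R)) R i) q (Pi.single i 1) = 0 := by
    intro q hq
    have ht : q 0 ∈ Set.Icc t₁ t₂ := ⟨hq.1 0, hq.2 0⟩
    have hs : q 3 ≤ 0 := hq.2 3
    have hzz : (wwPhi h q).2 2 ≤ h (q 0, ![(wwPhi h q).2 0, (wwPhi h q).2 1]) := by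
      change h (q 0, ![q 1, q 2]) + q 3 ≤ h (q 0, ![q 1, q 2])
      linarith
    exact (wwFlux_deriv h v p hh hv hp (1 / (2 * R)) R q).2
      (heuler _ (hsub _ ht) _ hzz) (hdiv _ (hsub _ ht) _ hzz)
  have hDt2 := hDt ((integrableOn_congr_fun hz measurableSet_Icc).2 integrableOn_zero)
  rw [setIntegral_congr_fun measurableSet_Icc hz] at hDt2
  have mt : ∀ {u : Fin 3 → ℝ} {c d : Fin 3 → ℝ}, c 0 = t₁ → d 0 = t₂ →
      u ∈ Set.Icc c d → u 0 ∈ Set.Icc t₁ t₂ := by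
    intro u c d hc hd hu
    exact ⟨hc ▸ hu.1 0, hd ▸ hu.2 0⟩
  have habs : |(-R)| = R := by rw [abs_neg, abs_of_pos hRpos]
  have habs' : |R| = R := abs_of_pos hRpos
  have z1 : ∀ r, |r| = R → ∫ u in Set.Icc ((![t₁, -R, -R, -R] : Fin 4 → ℝ) ∘ Fin.succAbove 1)
      ((![t₂, R, R, 0] : Fin 4 → ℝ) ∘ Fin.succAbove 1),
      wwFlux h v p (1 / (2 * R)) R 1 (Fin.insertNth (α := fun _ => ℝ) 1 r u) = 0 := by
    intro r hr
    refine setIntegral_eq_zero_of_forall_eq_zero fun u hu => ?_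
    have := hv0 (Fin.insertNth (α := fun _ => ℝ) 1 r u) (mt rfl rfl hu) (Or.inl hr.ge)
    simp [wwFlux, this]
  have z2 : ∀ r, |r| = R → ∫ u in Set.Icc ((![t₁, -R, -R, -R] : Fin 4 → ℝ) ∘ Fin.succAbove 2)
      ((![t₂, R, R, 0] : Fin 4 → ℝ) ∘ Fin.succAbove 2),
      wwFlux h v p (1 / (2 * R)) R 2 (Fin.insertNth (α := fun _ => ℝ) 2 r u) = 0 := by
    intro r hr
    refine setIntegral_eq_zero_of_forall_eq_zero fun u hu => ?_
    have := hv0 (Fin.insertNth (α := fun _ => ℝ) 2 r u) (mt rfl rfl hu) (Or.inr (Or.inl hr.ge))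
    simp [wwFlux, this]
  have z3 : ∫ u in Set.Icc ((![t₁, -R, -R, -R] : Fin 4 → ℝ) ∘ Fin.succAbove 3)
      ((![t₂, R, R, 0] : Fin 4 → ℝ) ∘ Fin.succAbove 3),
      wwFlux h v p (1 / (2 * R)) R 3 (Fin.insertNth (α := fun _ => ℝ) 3 (-R) u) = 0 := by
    refine setIntegral_eq_zero_of_forall_eq_zero fun u hu => ?_
    have := hv0 (Fin.insertNth (α := fun _ => ℝ) 3 (-R) u) (mt rfl rfl hu)
      (Or.inr (Or.inr le_rfl))
    have h3 : (Fin.insertNth (α := fun _ => ℝ) 3 (-R) u : Fin 4 → ℝ) 3 = -R := rfl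
    simp [wwFlux, wwKin, this, h3]
  have z4 : ∫ u in Set.Icc ((![t₁, -R, -R, -R] : Fin 4 → ℝ) ∘ Fin.succAbove 3)
      ((![t₂, R, R, 0] : Fin 4 → ℝ) ∘ Fin.succAbove 3),
      wwFlux h v p (1 / (2 * R)) R 3 (Fin.insertNth (α := fun _ => ℝ) 3 0 u) = 0 := by
    refine setIntegral_eq_zero_of_forall_eq_zero fun u hu => ?_
    have ht := hsub _ (mt rfl rfl hu)
    have hq : (Fin.insertNth (α := fun _ => ℝ) 3 0 u : Fin 4 → ℝ) = ![u 0, u 1, u 2, 0] := by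
      ext i; fin_cases i <;> rfl
    rw [hq]
    have k := hkin _ ht ![u 1, u 2]
    have pr := hpress _ ht ![u 1, u 2]
    have eP : wwPhi h ![u 0, u 1, u 2, 0] = (u 0, ![u 1, u 2, h (u 0, ![u 1, u 2])]) := by
      simp [wwPhi, wwL]
    have eL : wwL ![u 0, u 1, u 2, 0] = (u 0, ![u 1, u 2]) := rfl
    simp only [Matrix.cons_val_zero, Matrix.cons_val_one] at k pr
    simp [wwFlux, wwHead, eP, eL, pr]
    rw [← k]
    field_simp
    ring
  have hen : ∀ t ∈ Set.Icc t₁ t₂,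
      ∫ u in Set.Icc ((![t₁, -R, -R, -R] : Fin 4 → ℝ) ∘ Fin.succAbove 0)
      ((![t₂, R, R, 0] : Fin 4 → ℝ) ∘ Fin.succAbove 0),
      wwFlux h v p (1 / (2 * R)) R 0 (Fin.insertNth (α := fun _ => ℝ) 0 t u) = E t := by
    intro t ht
    rw [hE, ← ww_energy h v p hh.continuous hv.continuous R t hRpos (hh0 t ht)
      (fun q hq => hv0 q (hq ▸ ht))]
    have c1 : ((![t₁, -R, -R, -R] : Fin 4 → ℝ) ∘ Fin.succAbove 0) = ![-R, -R, -R] := by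
      ext i; fin_cases i <;> rfl
    have c2 : ((![t₂, R, R, 0] : Fin 4 → ℝ) ∘ Fin.succAbove 0) = ![R, R, 0] := by
      ext i; fin_cases i <;> rfl
    rw [c1, c2]
    refine setIntegral_congr_fun measurableSet_Icc fun u _ => ?_
    refine congrArg _ ?_
    ext i; fin_cases i <;> rfl
  rw [Fin.sum_univ_four] at hDt2
  have w1 := z1 R habs'
  have w2 := z1 (-R) habs
  have w3 := z2 R habs'
  have w4 := z2 (-R) habs
  have w5 := hen t₁ ⟨le_rfl, hlt⟩
  have w6 := hen t₂ ⟨hlt, le_rfl⟩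
  have key : (0 : ℝ) = (E t₂ - E t₁) + (0 - 0) + (0 - 0) + (0 - 0) := by
    refine Eq.trans (by simp) (hDt2.trans ?_)
    congr 1
    · congr 1
      · congr 1
        · exact congrArg₂ _ w6 w5
        · exact congrArg₂ _ w1 w2
      · exact congrArg₂ _ w3 w4
    · exact congrArg₂ _ z4 z3
  linarith

/-- Conservation of the energy
`E₀(t) = (1/2) ∫_{ℝ²} ∫_{−∞}^{h(t,x)} |v|² dy dx + (1/2) ∫_{ℝ²} h²`
for smooth, spatially compactly supported solutions of the gravity water-wave system. -/
theorem energy_is_conserved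
    (a b : ℝ) (h : ℝ × (Fin 2 → ℝ) → ℝ)
    (v : ℝ × (Fin 3 → ℝ) → Fin 3 → ℝ) (p : ℝ × (Fin 3 → ℝ) → ℝ)
    (hh : ContDiff ℝ (⊤ : ℕ∞) h) (hv : ContDiff ℝ (⊤ : ℕ∞) v)
    (hp : ContDiff ℝ (⊤ : ℕ∞) p)
    (K : Set (Fin 3 → ℝ)) (hK : IsCompact K)
    (hvK : ∀ t ∈ Set.Ioo a b, ∀ z ∉ K, v (t, z) = 0)
    (K' : Set (Fin 2 → ℝ)) (hK' : IsCompact K')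
    (hhK' : ∀ t ∈ Set.Ioo a b, ∀ x ∉ K', h (t, x) = 0)
    (heuler : ∀ t ∈ Set.Ioo a b, ∀ z : Fin 3 → ℝ, z 2 ≤ h (t, ![z 0, z 1]) →
      ∀ i : Fin 3,
      pt3 (fun r => v r i) (t, z)
          + ∑ k : Fin 3, v (t, z) k * ps3 (fun r => v r i) k (t, z)
        = -ps3 p i (t, z) - (if i = 2 then 1 else 0))
    (hdiv : ∀ t ∈ Set.Ioo a b, ∀ z : Fin 3 → ℝ, z 2 ≤ h (t, ![z 0, z 1]) →
      ∑ k : Fin 3, ps3 (fun r => v r k) k (t, z) = 0)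
    (hpress : ∀ t ∈ Set.Ioo a b, ∀ x : Fin 2 → ℝ, p (t, ![x 0, x 1, h (t, x)]) = 0)
    (hkin : ∀ t ∈ Set.Ioo a b, ∀ x : Fin 2 → ℝ,
      pt2 h (t, x) + v (t, ![x 0, x 1, h (t, x)]) 0 * ps2 h 0 (t, x)
          + v (t, ![x 0, x 1, h (t, x)]) 1 * ps2 h 1 (t, x)
        = v (t, ![x 0, x 1, h (t, x)]) 2)
    (E : ℝ → ℝ)
    (hE : ∀ t, E t =
      (1 / 2) * (∫ x : Fin 2 → ℝ,
          ∫ y in Set.Iic (h (t, x)), ∑ i : Fin 3, (v (t, ![x 0, x 1, y]) i) ^ 2)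
        + (1 / 2) * ∫ x : Fin 2 → ℝ, (h (t, x)) ^ 2) :
    ∀ t₁ ∈ Set.Ioo a b, ∀ t₂ ∈ Set.Ioo a b, E t₁ = E t₂ := by
  intro t₁ ht₁ t₂ ht₂
  rcases le_total t₁ t₂ with hle | hle
  · exact ww_step a b h v p hh hv hp K hK hvK K' hK' hhK' heuler hdiv hpress hkin E hE
      t₁ ht₁ t₂ ht₂ hle
  · exact (ww_step a b h v p hh hv hp K hK hvK K' hK' hhK' heuler hdiv hpress hkin E hE
      t₂ ht₂ t₁ ht₁ hle).symm
end
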